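/- There exists a universal constant c > 0 such that for any n ≥ 1 and any pair of increasing functions f, g : {−1,1}^n → [0,1], one has E_ν[fg] − E_ν[f]·E_ν[g] ≥ c·φ(∑_{i=1}^n I_i(f)·I_i(g)), where φ(x) = x / log(e/x). -/

import Mathlib

noncomputable section

/-- Expectation of `f : {−1,1}ⁿ → ℝ` (cube modelled as `Fin n → Bool`) w.r.t. the uniform
measure `ν^{⊗n}`. -/
def cubeExp {n : ℕ} (f : (Fin n → Bool) → ℝ) : ℝ :=
  (∑ x : Fin n → Bool, f x) / (2 ^ n : ℝ)

/-- The influence of coordinate `i` on `f : {−1,1}ⁿ → ℝ`: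
`I_i(f) = E_ν[|f(X) − f(X^{[i]})|]`. -/
def cubeInfluence {n : ℕ} (f : (Fin n → Bool) → ℝ) (i : Fin n) : ℝ :=
  cubeExp (fun x => |f x - f (Function.update x i (!x i))|)

end

namespace Tal

open Finset

noncomputable section

/-- sign of a bit -/
def eps (b : Bool) : ℝ := if b then 1 else -1

/-- biased product weight with mean vector `y` -/
def wt {n : ℕ} (y : Fin n → ℝ) (x : Fin n → Bool) : ℝ := ∏ j, (1 + eps (x j) * y j) / 2

/-- product weight without coordinate `i` -/
def wt' {n : ℕ} (i : Fin n) (y : Fin n → ℝ) (x : Fin n → Bool) : ℝ :=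
  ∏ j ∈ univ.erase i, (1 + eps (x j) * y j) / 2

/-- expectation under the biased product measure -/
def EE {n : ℕ} (y : Fin n → ℝ) (f : (Fin n → Bool) → ℝ) : ℝ := ∑ x, wt y x * f x

/-- discrete derivative -/
def DD {n : ℕ} (i : Fin n) (f : (Fin n → Bool) → ℝ) (x : Fin n → Bool) : ℝ :=
  (f (Function.update x i true) - f (Function.update x i false)) / 2

/-- normalised centred coordinate -/
def xi {n : ℕ} (y : Fin n → ℝ) (i : Fin n) (x : Fin n → Bool) : ℝ :=
  (eps (x i) - y i) / (1 - y i ^ 2)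

variable {n : ℕ}

lemma sum_pair (i : Fin n) (u : (Fin n → Bool) → ℝ) :
    ∑ x, u x = (1 / 2) * ∑ x, (u (Function.update x i true) + u (Function.update x i false)) := by
  have hinv : Function.Involutive (fun x : Fin n → Bool => Function.update x i (!x i)) := by
    intro x; simp
  have h1 : ∑ x, u (Function.update x i (!x i)) = ∑ x, u x :=
    Equiv.sum_comp (Function.Involutive.toPerm _ hinv) u
  have h2 : ∀ x : Fin n → Bool, u (Function.update x i true) + u (Function.update x i false)
      = u x + u (Function.update x i (!x i)) := by
    intro x
    cases hx : x i
    · have : Function.update x i false = x := by rw [← hx]; simp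
      rw [this]; simp; ring
    · have : Function.update x i true = x := by rw [← hx]; simp
      rw [this]; simp
  simp_rw [h2]
  rw [Finset.sum_add_distrib, h1]; ring

lemma wt'_update (i : Fin n) (y : Fin n → ℝ) (x : Fin n → Bool) (b : Bool) :
    wt' i y (Function.update x i b) = wt' i y x := by
  unfold wt'
  refine Finset.prod_congr rfl fun j hj => ?_
  rw [Function.update_of_ne (Finset.ne_of_mem_erase hj)]

lemma wt'_update_y (i : Fin n) (y : Fin n → ℝ) (x : Fin n → Bool) (b : ℝ) :
    wt' i (Function.update y i b) x = wt' i y x := by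
  unfold wt'
  refine Finset.prod_congr rfl fun j hj => ?_
  rw [Function.update_of_ne (Finset.ne_of_mem_erase hj)]

lemma wt_eq (i : Fin n) (y : Fin n → ℝ) (x : Fin n → Bool) :
    wt y x = (1 + eps (x i) * y i) / 2 * wt' i y x := by
  unfold wt wt'
  rw [Finset.mul_prod_erase univ (fun j => (1 + eps (x j) * y j) / 2) (mem_univ i)]

lemma EE_split (i : Fin n) (y : Fin n → ℝ) (f : (Fin n → Bool) → ℝ) :
    EE y f = (1 / 2) * ∑ x, wt' i y x * ((1 + y i) / 2 * f (Function.update x i true)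
      + (1 - y i) / 2 * f (Function.update x i false)) := by
  unfold EE
  rw [sum_pair i]
  congr 1
  refine Finset.sum_congr rfl fun x _ => ?_
  rw [wt_eq i, wt_eq i y (Function.update x i false), wt'_update, wt'_update]
  simp [eps]; ring

lemma DD_update (i : Fin n) (f : (Fin n → Bool) → ℝ) (x : Fin n → Bool) (b : Bool) :
    DD i f (Function.update x i b) = DD i f x := by
  simp [DD]

lemma EE_DD (i : Fin n) (y : Fin n → ℝ) (f : (Fin n → Bool) → ℝ) :
    EE y (DD i f) = (1 / 2) * ∑ x, wt' i y x * DD i f x := by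
  rw [EE_split i]
  congr 1
  refine Finset.sum_congr rfl fun x _ => ?_
  rw [DD_update, DD_update]; ring

lemma EE_DD' (i : Fin n) (y : Fin n → ℝ) (f : (Fin n → Bool) → ℝ) :
    EE y (DD i f) = ∑ x, wt' i y x * (eps (x i) / 2) * f x := by
  rw [EE_DD]
  conv_rhs => rw [sum_pair i]
  congr 1
  refine Finset.sum_congr rfl fun x _ => ?_
  rw [wt'_update, wt'_update]
  simp [eps, DD]; ring

lemma ibp (i : Fin n) (y : Fin n → ℝ) (hy : y i ^ 2 < 1) (h : (Fin n → Bool) → ℝ) :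
    EE y (fun x => xi y i x * h x) = EE y (DD i h) := by
  have h1 : 1 - y i ^ 2 ≠ 0 := by linarith
  rw [EE_DD, EE_split i]
  congr 1
  refine Finset.sum_congr rfl fun x _ => ?_
  congr 1
  simp [xi, eps, DD]
  field_simp
  ring

lemma EE_affine (i : Fin n) (y : Fin n → ℝ) (f : (Fin n → Bool) → ℝ) (a b : ℝ) :
    EE (Function.update y i a) f - EE (Function.update y i b) f = (a - b) * EE y (DD i f) := by
  rw [EE_split i, EE_split i (Function.update y i b), EE_DD, ← mul_sub, ← Finset.sum_sub_distrib,
    mul_left_comm, Finset.mul_sum (a := a - b)]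
  congr 1
  refine Finset.sum_congr rfl fun x _ => ?_
  simp only [wt'_update_y, Function.update_self, DD]
  ring

lemma EE_add (y : Fin n → ℝ) (f g : (Fin n → Bool) → ℝ) :
    EE y (fun x => f x + g x) = EE y f + EE y g := by
  simp [EE, mul_add, Finset.sum_add_distrib]

lemma EE_sub (y : Fin n → ℝ) (f g : (Fin n → Bool) → ℝ) :
    EE y (fun x => f x - g x) = EE y f - EE y g := by
  simp [EE, mul_sub, Finset.sum_sub_distrib]

lemma EE_smul (y : Fin n → ℝ) (c : ℝ) (f : (Fin n → Bool) → ℝ) :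
    EE y (fun x => c * f x) = c * EE y f := by
  simp only [EE, Finset.mul_sum]
  refine Finset.sum_congr rfl fun x _ => by ring

lemma EE_sum {κ : Type*} (s : Finset κ) (y : Fin n → ℝ) (f : κ → (Fin n → Bool) → ℝ) :
    EE y (fun x => ∑ k ∈ s, f k x) = ∑ k ∈ s, EE y (f k) := by
  simp only [EE, Finset.mul_sum]
  rw [Finset.sum_comm]

lemma wt_nonneg (y : Fin n → ℝ) (hy : ∀ i, |y i| ≤ 1) (x : Fin n → Bool) : 0 ≤ wt y x := by
  unfold wt
  refine Finset.prod_nonneg fun j _ => ?_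
  have := abs_le.1 (hy j)
  cases x j <;> simp [eps] <;> linarith

lemma EE_mono (y : Fin n → ℝ) (hy : ∀ i, |y i| ≤ 1) {f g : (Fin n → Bool) → ℝ}
    (h : ∀ x, f x ≤ g x) : EE y f ≤ EE y g :=
  Finset.sum_le_sum fun x _ => mul_le_mul_of_nonneg_left (h x) (wt_nonneg y hy x)

lemma EE_nonneg (y : Fin n → ℝ) (hy : ∀ i, |y i| ≤ 1) {f : (Fin n → Bool) → ℝ}
    (h : ∀ x, 0 ≤ f x) : 0 ≤ EE y f :=
  Finset.sum_nonneg fun x _ => mul_nonneg (wt_nonneg y hy x) (h x)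

lemma EE_prod (y : Fin n → ℝ) (c : Fin n → Bool → ℝ) :
    EE y (fun x => ∏ j, c j (x j))
      = ∏ j, ((1 + y j) / 2 * c j true + (1 - y j) / 2 * c j false) := by
  have h1 : EE y (fun x => ∏ j, c j (x j))
      = ∑ x : Fin n → Bool, ∏ j, ((1 + eps (x j) * y j) / 2 * c j (x j)) := by
    unfold EE wt
    refine Finset.sum_congr rfl fun x _ => by rw [Finset.prod_mul_distrib]
  rw [h1, ← Fintype.prod_sum (fun j b => (1 + eps b * y j) / 2 * c j b)]
  refine Finset.prod_congr rfl fun j _ => ?_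
  simp only [Fintype.sum_bool, eps, if_true, Bool.false_eq_true, if_false]; ring

lemma EE_one (y : Fin n → ℝ) : EE y (fun _ => 1) = 1 := by
  have := EE_prod y (fun _ _ => 1)
  simp only [Finset.prod_const_one] at this
  rw [this]
  refine Finset.prod_eq_one fun j _ => by ring

lemma EE_const (y : Fin n → ℝ) (c : ℝ) : EE y (fun _ => c) = c := by
  have := EE_smul y c (fun _ => 1)
  rw [EE_one] at this; simpa using this

lemma EE_sq (y : Fin n → ℝ) (hy : ∀ i, |y i| ≤ 1) (u : (Fin n → Bool) → ℝ) :
    (EE y u) ^ 2 ≤ EE y (fun x => u x ^ 2) := by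
  have h0 : 0 ≤ EE y (fun x => (u x - EE y u) ^ 2) := EE_nonneg y hy fun x => sq_nonneg _
  have h1 : EE y (fun x => (u x - EE y u) ^ 2)
      = EE y (fun x => u x ^ 2) - 2 * EE y u * EE y u + EE y u ^ 2 := by
    rw [← EE_smul, ← EE_sub]
    conv_rhs => rw [← EE_const y (EE y u ^ 2), ← EE_add]
    congr 1; funext x; ring
  nlinarith

lemma exp_le_aux (u : ℝ) : Real.exp u ≤ u + Real.exp (u ^ 2) := by
  have h2 := Real.add_one_le_exp (u ^ 2)
  rcases le_or_gt |u| 1 with h | h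
  · have h1 := (abs_le.1 (Real.abs_exp_sub_one_sub_id_le h)).2
    linarith
  · rcases lt_abs.1 h with h | h
    · have : Real.exp u ≤ Real.exp (u ^ 2) := Real.exp_le_exp.2 (by nlinarith)
      linarith
    · have : Real.exp u ≤ 1 := Real.exp_le_one_iff.2 (by linarith)
      nlinarith

lemma mgf (y : Fin n → ℝ) (hy : ∀ i, |y i| ≤ 1 / 2) (c : Fin n → ℝ) :
    EE y (fun x => Real.exp (∑ j, c j * xi y j x)) ≤ Real.exp (4 * ∑ j, c j ^ 2) := by
  have h1 := EE_prod y (fun j b => Real.exp (c j * ((eps b - y j) / (1 - y j ^ 2))))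
  have h2 : (fun x => Real.exp (∑ j, c j * xi y j x))
      = (fun x : Fin n → Bool => ∏ j, Real.exp (c j * ((eps (x j) - y j) / (1 - y j ^ 2)))) := by
    funext x; rw [Real.exp_sum]; rfl
  rw [h2, h1, Finset.mul_sum, Real.exp_sum]
  have hb : ∀ j, -(1/2) ≤ y j ∧ y j ≤ 1/2 := fun j => abs_le.1 (hy j)
  refine Finset.prod_le_prod (fun j _ => ?_) (fun j _ => ?_)
  · have := hb j
    have e1 := Real.exp_pos (c j * ((eps true - y j) / (1 - y j ^ 2)))
    have e2 := Real.exp_pos (c j * ((eps false - y j) / (1 - y j ^ 2)))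
    have p1 : 0 ≤ (1 + y j) / 2 := by linarith
    have p2 : 0 ≤ (1 - y j) / 2 := by linarith
    positivity
  · obtain ⟨l, u⟩ := hb j
    have hy1 : 1 - y j ≠ 0 := by linarith
    have hy2 : 1 + y j ≠ 0 := by linarith
    have hy3 : 1 - y j ^ 2 ≠ 0 := by nlinarith
    have q1 : (eps true - y j) / (1 - y j ^ 2) = 1 / (1 + y j) := by
      simp only [eps, if_true]; field_simp; ring
    have q2 : (eps false - y j) / (1 - y j ^ 2) = - (1 / (1 - y j)) := by
      simp [eps]; field_simp; ring
    rw [q1, q2]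
    have b1 : (c j * (1 / (1 + y j))) ^ 2 ≤ 4 * c j ^ 2 := by
      have : 1 / (1 + y j) ≤ 2 := by rw [div_le_iff₀ (by linarith)]; linarith
      have h0 : 0 ≤ 1 / (1 + y j) := by apply div_nonneg <;> linarith
      have : (1 / (1 + y j)) ^ 2 ≤ 4 := by nlinarith
      rw [mul_pow]; nlinarith [sq_nonneg (c j)]
    have b2 : (c j * -(1 / (1 - y j))) ^ 2 ≤ 4 * c j ^ 2 := by
      have : 1 / (1 - y j) ≤ 2 := by rw [div_le_iff₀ (by linarith)]; linarith
      have h0 : 0 ≤ 1 / (1 - y j) := by apply div_nonneg <;> linarith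
      have : (-(1 / (1 - y j))) ^ 2 ≤ 4 := by nlinarith
      rw [mul_pow]; nlinarith [sq_nonneg (c j)]
    have e1 := (exp_le_aux (c j * (1 / (1 + y j)))).trans
      (add_le_add_right (Real.exp_le_exp.2 b1) _)
    have e2 := (exp_le_aux (c j * -(1 / (1 - y j)))).trans
      (add_le_add_right (Real.exp_le_exp.2 b2) _)
    have p1 : 0 ≤ (1 + y j) / 2 := by linarith
    have p2 : 0 ≤ (1 - y j) / 2 := by linarith
    have := add_le_add (mul_le_mul_of_nonneg_left e1 p1) (mul_le_mul_of_nonneg_left e2 p2)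
    refine this.trans (le_of_eq ?_)
    field_simp
    ring

lemma xi_update_ne (y : Fin n → ℝ) {i j : Fin n} (h : i ≠ j) (x : Fin n → Bool) (b : Bool) :
    xi y i (Function.update x j b) = xi y i x := by
  simp [xi, Function.update_of_ne h]

lemma variance_bd (y : Fin n → ℝ) (hy : ∀ i, |y i| ≤ 1 / 2) (r : Fin n → (Fin n → Bool) → ℝ)
    (hr : ∀ i x b, r i (Function.update x i b) = r i x) :
    EE y (fun x => (∑ i, xi y i x * r i x) ^ 2) ≤
      ∑ i, (1 / (1 - y i ^ 2)) * EE y (fun x => r i x ^ 2)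
        + ∑ i, ∑ j, EE y (fun x => DD j (r i) x ^ 2) := by
  have hy1 : ∀ i, |y i| ≤ 1 := fun i => (hy i).trans (by norm_num)
  have hy2 : ∀ i, y i ^ 2 < 1 := fun i => by
    obtain ⟨l, u⟩ := abs_le.1 (hy i); nlinarith
  have h1 : EE y (fun x => (∑ i, xi y i x * r i x) ^ 2)
      = ∑ i, ∑ j, EE y (fun x => xi y j x * (xi y i x * (r i x * r j x))) := by
    simp_rw [← EE_sum]
    congr 1; funext x
    rw [sq, Finset.sum_mul_sum]
    refine Finset.sum_congr rfl fun i _ => Finset.sum_congr rfl fun j _ => by ring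
  have h2 : ∀ i j, EE y (fun x => xi y j x * (xi y i x * (r i x * r j x))) ≤
      (if i = j then (1 / (1 - y i ^ 2)) * EE y (fun x => r i x ^ 2) else 0)
      + (1 / 2) * (EE y (fun x => DD j (r i) x ^ 2) + EE y (fun x => DD i (r j) x ^ 2)) := by
    intro i j
    have hnn : 0 ≤ (1 / 2) *
        (EE y (fun x => DD j (r i) x ^ 2) + EE y (fun x => DD i (r j) x ^ 2)) := by
      have a1 : 0 ≤ EE y (fun x => DD j (r i) x ^ 2) := EE_nonneg y hy1 fun x => sq_nonneg _
      have a2 : 0 ≤ EE y (fun x => DD i (r j) x ^ 2) := EE_nonneg y hy1 fun x => sq_nonneg _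
      linarith
    rw [ibp j y (hy2 j)]
    by_cases hij : i = j
    · subst hij
      rw [if_pos rfl]
      have : EE y (DD i fun x => xi y i x * (r i x * r i x))
          = (1 / (1 - y i ^ 2)) * EE y (fun x => r i x ^ 2) := by
        rw [← EE_smul]
        congr 1; funext x
        simp only [DD, hr, xi, Function.update_self, eps]
        have : 1 - y i ^ 2 ≠ 0 := by linarith [hy2 i]
        simp; field_simp; ring
      linarith
    · rw [if_neg hij, zero_add]
      have e1 : (DD j fun x => xi y i x * (r i x * r j x))
          = fun x => xi y i x * (DD j (r i) x * r j x) := by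
        funext x
        simp only [DD, hr j, xi_update_ne y hij]; ring
      rw [e1, ibp i y (hy2 i)]
      have e2 : (DD i fun x => DD j (r i) x * r j x)
          = fun x => DD j (r i) x * DD i (r j) x := by
        funext x
        have : ∀ b, DD j (r i) (Function.update x i b) = DD j (r i) x := by
          intro b
          simp only [DD]
          rw [Function.update_comm hij, Function.update_comm hij, hr, hr]
        conv_lhs => rw [DD]
        simp only [this]
        simp only [DD]; ring
      rw [e2, ← EE_add, ← EE_smul]
      refine EE_mono y hy1 fun x => ?_
      nlinarith [sq_nonneg (DD j (r i) x - DD i (r j) x)]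
  rw [h1]
  refine (Finset.sum_le_sum fun i _ => Finset.sum_le_sum fun j _ => h2 i j).trans (le_of_eq ?_)
  simp only [Finset.sum_add_distrib, Finset.sum_ite_eq, Finset.mem_univ, if_true, ← Finset.mul_sum]
  rw [Finset.sum_comm (f := fun i j => EE y fun x => DD i (r j) x ^ 2)]
  ring

lemma dual_eq (y : Fin n → ℝ) (hy : ∀ i, |y i| ≤ 1 / 2) (f : (Fin n → Bool) → ℝ)
    (r : Fin n → (Fin n → Bool) → ℝ) (hr : ∀ i x b, r i (Function.update x i b) = r i x) :
    ∑ i, EE y (fun x => DD i f x * r i x) = EE y (fun x => f x * ∑ i, xi y i x * r i x) := by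
  have hy2 : ∀ i, y i ^ 2 < 1 := fun i => by
    obtain ⟨l, u⟩ := abs_le.1 (hy i); nlinarith
  have h : ∀ i, EE y (fun x => DD i f x * r i x) = EE y (fun x => xi y i x * (f x * r i x)) := by
    intro i
    rw [ibp i y (hy2 i)]
    congr 1; funext x
    simp only [DD, hr]; ring
  simp_rw [h]
  rw [← EE_sum]
  congr 1; funext x
  rw [Finset.mul_sum]
  exact Finset.sum_congr rfl fun i _ => by ring

lemma dual_bd (y : Fin n → ℝ) (hy : ∀ i, |y i| ≤ 1 / 2) (f : (Fin n → Bool) → ℝ) (K : ℝ)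
    (hf : ∀ x, |f x| ≤ K)
    (r : Fin n → (Fin n → Bool) → ℝ) (hr : ∀ i x b, r i (Function.update x i b) = r i x) :
    (∑ i, EE y (fun x => DD i f x * r i x)) ^ 2 ≤
      K ^ 2 * (∑ i, (1 / (1 - y i ^ 2)) * EE y (fun x => r i x ^ 2)
        + ∑ i, ∑ j, EE y (fun x => DD j (r i) x ^ 2)) := by
  have hy1 : ∀ i, |y i| ≤ 1 := fun i => (hy i).trans (by norm_num)
  rw [dual_eq y hy f r hr]
  refine (EE_sq y hy1 _).trans ?_
  refine le_trans ?_ (mul_le_mul_of_nonneg_left (variance_bd y hy r hr) (sq_nonneg K))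
  rw [← EE_smul]
  refine EE_mono y hy1 fun x => ?_
  rw [mul_pow]
  have : f x ^ 2 ≤ K ^ 2 := sq_le_sq' (abs_le.1 (hf x)).1 (abs_le.1 (hf x)).2
  exact mul_le_mul_of_nonneg_right this (sq_nonneg _)

/-- exponential cut-off function -/
def ex (y : Fin n → ℝ) (c : Fin n → ℝ) (τ : ℝ) (x : Fin n → Bool) : ℝ :=
  Real.exp (τ * ∑ j, c j * xi y j x - 16 * τ ^ 2)

lemma ex_sq (y : Fin n → ℝ) (hy : ∀ i, |y i| ≤ 1 / 2) (c : Fin n → ℝ) (hc : ∑ j, c j ^ 2 ≤ 1)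
    (τ : ℝ) : EE y (fun x => ex y c τ x ^ 2) ≤ Real.exp (-16 * τ ^ 2) := by
  have h1 : (fun x => ex y c τ x ^ 2)
      = fun x => Real.exp (-32 * τ ^ 2) * Real.exp (∑ j, (2 * τ * c j) * xi y j x) := by
    funext x
    have : ∑ j, (2 * τ * c j) * xi y j x = 2 * τ * ∑ j, c j * xi y j x := by
      rw [Finset.mul_sum]; exact Finset.sum_congr rfl fun i _ => by ring
    rw [this, ex, ← Real.exp_add, ← Real.exp_nat_mul]
    congr 1; push_cast; ring
  rw [h1, EE_smul]
  refine (mul_le_mul_of_nonneg_left (mgf y hy _) (Real.exp_pos _).le).trans ?_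
  rw [← Real.exp_add]
  apply Real.exp_le_exp.2
  have : ∑ j, (2 * τ * c j) ^ 2 = 4 * τ ^ 2 * ∑ j, c j ^ 2 := by
    rw [Finset.mul_sum]; exact Finset.sum_congr rfl fun i _ => by ring
  rw [this]
  nlinarith [sq_nonneg τ]

lemma exp_diff (u v : ℝ) :
    (Real.exp u - Real.exp v) ^ 2 ≤ 2 * (u - v) ^ 2 * (Real.exp u ^ 2 + Real.exp v ^ 2) := by
  have key : ∀ u v : ℝ, Real.exp u - Real.exp v ≤ Real.exp u * (u - v) := by
    intro u v
    have h := Real.add_one_le_exp (v - u)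
    have h2 : Real.exp v = Real.exp u * Real.exp (v - u) := by
      rw [← Real.exp_add]; congr 1; ring
    rw [h2]; nlinarith [Real.exp_pos u]
  have a := key u v
  have b := key v u
  have pu := Real.exp_pos u
  have pv := Real.exp_pos v
  have h : |Real.exp u - Real.exp v| ≤ |u - v| * (Real.exp u + Real.exp v) := by
    have c1 := le_abs_self (u - v)
    have c2 := neg_abs_le (u - v)
    have c0 := abs_nonneg (u - v)
    rw [abs_le]; constructor <;> nlinarith
  have h2 := pow_le_pow_left₀ (abs_nonneg _) h 2
  rw [sq_abs, mul_pow, sq_abs] at h2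
  nlinarith [sq_nonneg (u - v), mul_nonneg (sq_nonneg (u - v))
    (sq_nonneg (Real.exp u - Real.exp v))]

lemma ex_DD (y : Fin n → ℝ) (hy : ∀ i, |y i| ≤ 1 / 2) (c : Fin n → ℝ) (τ : ℝ) (j : Fin n) :
    EE y (fun x => DD j (ex y c τ) x ^ 2) ≤
      16 * τ ^ 2 * c j ^ 2 * EE y (fun x => ex y c τ x ^ 2) := by
  obtain ⟨l, u⟩ := abs_le.1 (hy j)
  have hq : 3 / 4 ≤ 1 - y j ^ 2 := by nlinarith
  have hq0 : (1 - y j ^ 2) ≠ 0 := by linarith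
  have hdiff : ∀ x : Fin n → Bool,
      ∑ k, c k * xi y k (Function.update x j true) - ∑ k, c k * xi y k (Function.update x j false)
        = 2 * c j / (1 - y j ^ 2) := by
    intro x
    rw [← Finset.sum_sub_distrib, Finset.sum_eq_single j]
    · simp [xi, eps]; field_simp; ring
    · intro k _ hk
      rw [xi_update_ne y hk, xi_update_ne y hk, sub_self]
    · simp
  have hw : ∀ x, 0 ≤ wt' j y x := by
    intro x
    refine Finset.prod_nonneg fun k _ => ?_
    have := abs_le.1 (hy k)
    cases x k <;> simp [eps] <;> linarith
  rw [EE_split j, EE_split j, mul_left_comm, Finset.mul_sum (a := 16 * τ ^ 2 * c j ^ 2)]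
  refine mul_le_mul_of_nonneg_left (Finset.sum_le_sum fun x _ => ?_) (by norm_num)
  rw [mul_left_comm]
  refine mul_le_mul_of_nonneg_left ?_ (hw x)
  rw [DD_update, DD_update, DD]
  set P := Function.update x j true
  set Q := Function.update x j false
  have h1 := exp_diff (τ * ∑ k, c k * xi y k P - 16 * τ ^ 2) (τ * ∑ k, c k * xi y k Q - 16 * τ ^ 2)
  have h2 : (τ * ∑ k, c k * xi y k P - 16 * τ ^ 2 - (τ * ∑ k, c k * xi y k Q - 16 * τ ^ 2))
      = τ * (2 * c j / (1 - y j ^ 2)) := by rw [← hdiff x]; ring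
  rw [h2] at h1
  change (ex y c τ P - ex y c τ Q) ^ 2 ≤ _ * (ex y c τ P ^ 2 + ex y c τ Q ^ 2) at h1
  have h3 : (τ * (2 * c j / (1 - y j ^ 2))) ^ 2 ≤ 64 / 9 * (τ ^ 2 * c j ^ 2) := by
    have : (1 / (1 - y j ^ 2)) ^ 2 ≤ 16 / 9 := by
      have h5 : 1 / (1 - y j ^ 2) ≤ 4 / 3 := by
        rw [div_le_iff₀ (by linarith)]; linarith
      have h6 : 0 ≤ 1 / (1 - y j ^ 2) := by apply div_nonneg <;> linarith
      nlinarith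
    have h7 : (τ * (2 * c j / (1 - y j ^ 2))) ^ 2
      = 4 * (τ ^ 2 * c j ^ 2) * (1 / (1 - y j ^ 2)) ^ 2 := by field_simp; ring
    rw [h7]
    have : 0 ≤ τ ^ 2 * c j ^ 2 := by positivity
    nlinarith
  have h8 : 16 * τ ^ 2 * c j ^ 2 = 16 * (τ ^ 2 * c j ^ 2) := by ring
  rw [h8]
  clear h8
  have hA : 0 ≤ ex y c τ P ^ 2 := sq_nonneg _
  have hB : 0 ≤ ex y c τ Q ^ 2 := sq_nonneg _
  have ht : 0 ≤ τ ^ 2 * c j ^ 2 := by positivity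
  generalize ex y c τ P ^ 2 = A at *
  generalize ex y c τ Q ^ 2 = B at *
  generalize τ ^ 2 * c j ^ 2 = T at *
  have h4 : (ex y c τ P - ex y c τ Q) ^ 2 ≤ 2 * (64 / 9 * T) * (A + B) :=
    h1.trans (mul_le_mul_of_nonneg_right (by linarith) (by linarith))
  have h5 : (1 + y j) / 2 * A + (1 - y j) / 2 * B ≥ (A + B) / 4 := by nlinarith
  have h6 : T * ((1 + y j) / 2 * A + (1 - y j) / 2 * B) ≥ T * ((A + B) / 4) :=
    mul_le_mul_of_nonneg_left h5 ht
  have h7 : 0 ≤ T * (A + B) := mul_nonneg ht (by linarith)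
  calc _ = (ex y c τ P - ex y c τ Q) ^ 2 / 4 := by ring
    _ ≤ 16 * (T * ((1 + y j) / 2 * A + (1 - y j) / 2 * B)) := by linarith
    _ = _ := by ring

lemma DD_smul (i : Fin n) (a : ℝ) (f : (Fin n → Bool) → ℝ) :
    DD i (fun x => a * f x) = fun x => a * DD i f x := by
  funext x; simp [DD]; ring

lemma key_bd (y : Fin n → ℝ) (hy : ∀ i, |y i| ≤ 1 / 2) (f : (Fin n → Bool) → ℝ)
    (hf : ∀ x, |f x| ≤ 1) (hm : ∀ i x, 0 ≤ DD i f x)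
    (N : Fin n → Fin n → ℝ) (hN0 : ∀ i, N i i = 0) (hN : ∀ i, ∑ j, N i j ^ 2 ≤ 1)
    (ρ : Fin n → ℝ) (hρ : ∀ i, 0 ≤ ρ i) (τ : ℝ) (hτ : 1 ≤ τ) :
    ∑ i, ρ i * ∑ j, N i j * EE y (DD j (DD i f)) ≤
      16 * τ * ∑ i, ρ i * EE y (DD i f) + 5 * Real.exp (-8 * τ ^ 2) * √(∑ i, ρ i ^ 2) := by
  have hy1 : ∀ i, |y i| ≤ 1 := fun i => (hy i).trans (by norm_num)
  have hy2 : ∀ i, y i ^ 2 < 1 := fun i => by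
    obtain ⟨l, u⟩ := abs_le.1 (hy i); nlinarith
  have hr : ∀ i x b, (fun x => ρ i * ex y (N i) τ x) (Function.update x i b)
      = (fun x => ρ i * ex y (N i) τ x) x := by
    intro i x b
    simp only [ex]
    congr 4
    refine Finset.sum_congr rfl fun j _ => ?_
    by_cases h : j = i
    · subst h; simp [hN0]
    · rw [xi_update_ne y h]
  have hd := dual_bd y hy f 1 hf (fun i x => ρ i * ex y (N i) τ x) hr
  set X := ∑ i, EE y (fun x => DD i f x * (ρ i * ex y (N i) τ x)) with hX
  have hV : ∑ i, (1 / (1 - y i ^ 2)) * EE y (fun x => (ρ i * ex y (N i) τ x) ^ 2)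
        + ∑ i, ∑ j, EE y (fun x => DD j (fun x => ρ i * ex y (N i) τ x) x ^ 2)
        ≤ 20 * τ ^ 2 * Real.exp (-16 * τ ^ 2) * ∑ i, ρ i ^ 2 := by
    rw [← Finset.sum_add_distrib, Finset.mul_sum]
    refine Finset.sum_le_sum fun i _ => ?_
    have e0 := ex_sq y hy (N i) (hN i) τ
    have e1 : 0 ≤ EE y (fun x => ex y (N i) τ x ^ 2) := EE_nonneg y hy1 fun x => sq_nonneg _
    have s1 : EE y (fun x => (ρ i * ex y (N i) τ x) ^ 2)
        = ρ i ^ 2 * EE y (fun x => ex y (N i) τ x ^ 2) := by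
      rw [← EE_smul]; congr 1; funext x; ring
    have s2 : ∀ j, EE y (fun x => DD j (fun x => ρ i * ex y (N i) τ x) x ^ 2)
        ≤ ρ i ^ 2 * (16 * τ ^ 2 * EE y (fun x => ex y (N i) τ x ^ 2)) * N i j ^ 2 := by
      intro j
      have := ex_DD y hy (N i) τ j
      have h3 : EE y (fun x => DD j (fun x => ρ i * ex y (N i) τ x) x ^ 2)
        = ρ i ^ 2 * EE y (fun x => DD j (ex y (N i) τ) x ^ 2) := by
        rw [← EE_smul, DD_smul]; congr 1; funext x; ring
      rw [h3]
      refine (mul_le_mul_of_nonneg_left this (sq_nonneg _)).trans (le_of_eq (by ring))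
    have s3 := Finset.sum_le_sum fun j (_ : j ∈ univ) => s2 j
    rw [← Finset.mul_sum] at s3
    have s4 : ρ i ^ 2 * (16 * τ ^ 2 * EE y (fun x => ex y (N i) τ x ^ 2)) * ∑ j, N i j ^ 2
        ≤ ρ i ^ 2 * (16 * τ ^ 2 * EE y (fun x => ex y (N i) τ x ^ 2)) * 1 :=
      mul_le_mul_of_nonneg_left (hN i) (by positivity)
    have s5 : 1 / (1 - y i ^ 2) ≤ 4 := by
      obtain ⟨l, u⟩ := abs_le.1 (hy i)
      rw [div_le_iff₀ (by linarith [hy2 i])]; nlinarith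
    have s6 : (1 / (1 - y i ^ 2)) * (ρ i ^ 2 * EE y (fun x => ex y (N i) τ x ^ 2))
        ≤ 4 * (ρ i ^ 2 * EE y (fun x => ex y (N i) τ x ^ 2)) :=
      mul_le_mul_of_nonneg_right s5 (by positivity)
    rw [s1]
    generalize EE y (fun x => ex y (N i) τ x ^ 2) = W at *
    have t1 : 1 ≤ τ ^ 2 := by nlinarith
    have t2 : 0 ≤ ρ i ^ 2 := sq_nonneg _
    have t3 : 4 * (ρ i ^ 2 * W) + ρ i ^ 2 * (16 * τ ^ 2 * W) * 1 ≤ 20 * τ ^ 2 * (ρ i ^ 2 * W) := by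
      have : 0 ≤ ρ i ^ 2 * W := mul_nonneg t2 e1
      nlinarith
    have t4 : 20 * τ ^ 2 * (ρ i ^ 2 * W) ≤ 20 * τ ^ 2 * (ρ i ^ 2 * Real.exp (-16 * τ ^ 2)) := by
      gcongr
    calc _ ≤ _ := add_le_add s6 (s3.trans s4)
      _ ≤ _ := t3
      _ ≤ _ := t4
      _ = _ := by ring
  have hXle : X ≤ τ * (5 * Real.exp (-8 * τ ^ 2) * √(∑ i, ρ i ^ 2)) := by
    have hs : 0 ≤ ∑ i, ρ i ^ 2 := Finset.sum_nonneg fun i _ => sq_nonneg _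
    refine abs_le_of_sq_le_sq' ?_ (by positivity) |>.2
    refine hd.trans ?_
    rw [one_pow, one_mul]
    refine hV.trans ?_
    have : (τ * (5 * Real.exp (-8 * τ ^ 2) * √(∑ i, ρ i ^ 2))) ^ 2
        = 25 * τ ^ 2 * Real.exp (-16 * τ ^ 2) * ∑ i, ρ i ^ 2 := by
      rw [mul_pow, mul_pow, mul_pow, Real.sq_sqrt hs, ← Real.exp_nat_mul]
      have : ((2 : ℕ) : ℝ) * (-8 * τ ^ 2) = -16 * τ ^ 2 := by push_cast; ring
      rw [this]; ring
    rw [this]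
    gcongr
    norm_num
  have hmain : ∀ i, ρ i * ∑ j, N i j * EE y (DD j (DD i f)) ≤
      16 * τ * (ρ i * EE y (DD i f))
        + (1 / τ) * EE y (fun x => DD i f x * (ρ i * ex y (N i) τ x)) := by
    intro i
    have h1 : ρ i * ∑ j, N i j * EE y (DD j (DD i f))
        = EE y (fun x => ρ i * (DD i f x * ∑ j, N i j * xi y j x)) := by
      rw [EE_smul]
      congr 1
      simp_rw [Finset.mul_sum]
      rw [EE_sum]
      refine Finset.sum_congr rfl fun j _ => ?_
      rw [← ibp j y (hy2 j), ← EE_smul]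
      congr 1; funext x; ring
    rw [h1, ← EE_smul, ← EE_smul, ← EE_smul, ← EE_add]
    refine EE_mono y hy1 fun x => ?_
    have hτ0 : 0 < τ := by linarith
    have h2 : ∑ j, N i j * xi y j x ≤ 16 * τ + (1 / τ) * ex y (N i) τ x := by
      have h3 := Real.add_one_le_exp (τ * ∑ j, N i j * xi y j x - 16 * τ ^ 2)
      change _ ≤ ex y (N i) τ x at h3
      have h4 : τ * ∑ j, N i j * xi y j x ≤ τ * (16 * τ + (1 / τ) * ex y (N i) τ x) := by
        have : τ * (16 * τ + (1 / τ) * ex y (N i) τ x) = 16 * τ ^ 2 + ex y (N i) τ x := by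
          field_simp
        rw [this]; linarith
      exact le_of_mul_le_mul_left h4 hτ0
    have h5 := mul_le_mul_of_nonneg_left h2 (mul_nonneg (hρ i) (hm i x))
    calc _ = _ := by ring
      _ ≤ _ := h5
      _ = _ := by ring
  refine (Finset.sum_le_sum fun i _ => hmain i).trans ?_
  rw [Finset.sum_add_distrib, ← Finset.mul_sum, ← Finset.mul_sum]
  have hτ0 : 0 < τ := by linarith
  have : 1 / τ * X ≤ 5 * Real.exp (-8 * τ ^ 2) * √(∑ i, ρ i ^ 2) := by
    rw [one_div, inv_mul_le_iff₀ hτ0]; exact hXle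
  linarith

/-- row norms of the second derivative matrix -/
def sg (y : Fin n → ℝ) (f : (Fin n → Bool) → ℝ) (i : Fin n) : ℝ :=
  √(∑ j, EE y (DD j (DD i f)) ^ 2)

lemma DD_DD_self (i : Fin n) (f : (Fin n → Bool) → ℝ) : DD i (DD i f) = fun _ => 0 := by
  funext x
  conv_lhs => rw [DD]
  rw [DD_update, DD_update]; simp

/-- the decomposition of the row norms -/
lemma sg_bd (y : Fin n → ℝ) (hy : ∀ i, |y i| ≤ 1 / 2) (f : (Fin n → Bool) → ℝ)
    (hf : ∀ x, |f x| ≤ 1) (hm : ∀ i x, 0 ≤ DD i f x) (τ : ℝ) (hτ : 1 ≤ τ) :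
    ∃ ρ : Fin n → ℝ, (∀ i, 0 ≤ ρ i) ∧ (∀ i, sg y f i ≤ 16 * τ * EE y (DD i f) + ρ i) ∧
      √(∑ i, ρ i ^ 2) ≤ 5 * Real.exp (-8 * τ ^ 2) := by
  set ρ : Fin n → ℝ := fun i => max (sg y f i - 16 * τ * EE y (DD i f)) 0 with hρd
  have hρ : ∀ i, 0 ≤ ρ i := fun i => le_max_right _ _
  refine ⟨ρ, hρ, fun i => by linarith [le_max_left (sg y f i - 16 * τ * EE y (DD i f)) 0], ?_⟩
  have hss : ∀ i, sg y f i ^ 2 = ∑ j, EE y (DD j (DD i f)) ^ 2 := fun i =>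
    Real.sq_sqrt (Finset.sum_nonneg fun j _ => sq_nonneg _)
  have hk := key_bd y hy f hf hm (fun i j => EE y (DD j (DD i f)) / sg y f i)
    (fun i => by rw [DD_DD_self, EE_const]; simp)
    (fun i => by
      simp_rw [div_pow]
      rw [← Finset.sum_div, ← hss i]
      exact div_self_le_one _) ρ hρ τ hτ
  have h1 : ∀ i, ∑ j, EE y (DD j (DD i f)) / sg y f i * EE y (DD j (DD i f)) = sg y f i := by
    intro i
    have : ∑ j, EE y (DD j (DD i f)) / sg y f i * EE y (DD j (DD i f))
      = (∑ j, EE y (DD j (DD i f)) ^ 2) / sg y f i := by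
      rw [Finset.sum_div]; exact Finset.sum_congr rfl fun j _ => by ring
    rw [this, ← hss i, sq, mul_self_div_self]
  simp only [h1] at hk
  have h2 : ∀ i, ρ i ^ 2 = ρ i * sg y f i - 16 * τ * (ρ i * EE y (DD i f)) := by
    intro i
    rcases max_choice (sg y f i - 16 * τ * EE y (DD i f)) 0 with h | h
    · have : ρ i = sg y f i - 16 * τ * EE y (DD i f) := h
      rw [sq]; nth_rewrite 2 [this]; ring
    · have : ρ i = 0 := h
      rw [this]; ring
  have h3 : ∑ i, ρ i ^ 2 ≤ 5 * Real.exp (-8 * τ ^ 2) * √(∑ i, ρ i ^ 2) := by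
    simp_rw [h2] at hk ⊢
    rw [Finset.sum_sub_distrib, ← Finset.mul_sum]
    rw [Finset.sum_sub_distrib, ← Finset.mul_sum] at hk
    linarith
  have hs : 0 ≤ ∑ i, ρ i ^ 2 := Finset.sum_nonneg fun i _ => sq_nonneg _
  rcases (Real.sqrt_nonneg (∑ i, ρ i ^ 2)).eq_or_lt with h | h
  · rw [← h]; positivity
  · nth_rewrite 1 [← Real.mul_self_sqrt hs] at h3
    exact le_of_mul_le_mul_right h3 h

lemma a_bd (y : Fin n → ℝ) (hy : ∀ i, |y i| ≤ 1 / 2) (f : (Fin n → Bool) → ℝ)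
    (K B : ℝ) (hK : 0 ≤ K) (hB : 0 ≤ B) (hf : ∀ x, |f x| ≤ K) (hyB : ∀ i, 1 / (1 - y i ^ 2) ≤ B ^ 2) :
    √(∑ i, EE y (DD i f) ^ 2) ≤ K * B := by
  have hd := dual_bd y hy f K hf (fun i _ => EE y (DD i f)) (fun _ _ _ => rfl)
  have hs : 0 ≤ ∑ i, EE y (DD i f) ^ 2 := Finset.sum_nonneg fun i _ => sq_nonneg _
  have h1 : ∀ i, EE y (fun x => DD i f x * EE y (DD i f)) = EE y (DD i f) ^ 2 := by
    intro i
    rw [sq, ← EE_smul]; congr 1; funext x; ring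
  have h2 : ∀ i j, EE y (fun x => DD j (fun _ => EE y (DD i f)) x ^ 2) = 0 := by
    intro i j
    simp [DD, EE_const]
  simp only [h1, h2, EE_const, Finset.sum_const_zero, add_zero] at hd
  have h3 : ∑ i, 1 / (1 - y i ^ 2) * EE y (DD i f) ^ 2 ≤ B ^ 2 * ∑ i, EE y (DD i f) ^ 2 := by
    rw [Finset.mul_sum]
    exact Finset.sum_le_sum fun i _ => mul_le_mul_of_nonneg_right (hyB i) (sq_nonneg _)
  have h4 := hd.trans (mul_le_mul_of_nonneg_left h3 (sq_nonneg K))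
  apply Real.sqrt_le_iff.2 ⟨by positivity, ?_⟩
  rcases hs.eq_or_lt with h | h
  · rw [← h]; positivity
  · have : (∑ i, EE y (DD i f) ^ 2) * (∑ i, EE y (DD i f) ^ 2)
      ≤ (K * B) ^ 2 * (∑ i, EE y (DD i f) ^ 2) := by nlinarith
    exact le_of_mul_le_mul_right this h

/-- second-level inequality at a point `y` -/
lemma level_two (y : Fin n → ℝ) (hy : ∀ i, |y i| ≤ 1 / 2) (f g : (Fin n → Bool) → ℝ)
    (hf : ∀ x, |f x| ≤ 1) (hmf : ∀ i x, 0 ≤ DD i f x)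
    (hg : ∀ x, |g x| ≤ 1) (hmg : ∀ i x, 0 ≤ DD i g x) (τ : ℝ) (hτ : 1 ≤ τ) :
    -(256 * τ ^ 2 * ∑ i, EE y (DD i f) * EE y (DD i g) + 345 * Real.exp (- τ ^ 2)) ≤
      ∑ i, ∑ j, EE y (DD j (DD i f)) * EE y (DD j (DD i g)) := by
  have hy1 : ∀ i, |y i| ≤ 1 := fun i => (hy i).trans (by norm_num)
  obtain ⟨ρ, hρ, hsf, hρb⟩ := sg_bd y hy f hf hmf τ hτ
  obtain ⟨ρ', hρ', hsg, hρb'⟩ := sg_bd y hy g hg hmg τ hτ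
  have hyB : ∀ i, 1 / (1 - y i ^ 2) ≤ (2 : ℝ) ^ 2 := by
    intro i
    obtain ⟨l, u⟩ := abs_le.1 (hy i)
    rw [div_le_iff₀ (by nlinarith)]; nlinarith
  have haf := a_bd y hy f 1 2 (by norm_num) (by norm_num) hf hyB
  have hag := a_bd y hy g 1 2 (by norm_num) (by norm_num) hg hyB
  have ha0 : ∀ i, 0 ≤ EE y (DD i f) := fun i => EE_nonneg y hy1 (hmf i)
  have hb0 : ∀ i, 0 ≤ EE y (DD i g) := fun i => EE_nonneg y hy1 (hmg i)
  have hτ0 : 0 < τ := by linarith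
  have c1 : ∀ i, - (sg y f i * sg y g i) ≤ ∑ j, EE y (DD j (DD i f)) * EE y (DD j (DD i g)) := by
    intro i
    have := Real.sum_mul_le_sqrt_mul_sqrt univ (fun j => - EE y (DD j (DD i f)))
      (fun j => EE y (DD j (DD i g)))
    simp only [neg_mul, Finset.sum_neg_distrib, neg_sq] at this
    change _ ≤ sg y f i * sg y g i at this
    linarith
  have c2 : ∀ i, sg y f i * sg y g i ≤ 256 * τ ^ 2 * (EE y (DD i f) * EE y (DD i g))
      + 16 * τ * (EE y (DD i f) * ρ' i) + 16 * τ * (ρ i * EE y (DD i g)) + ρ i * ρ' i := by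
    intro i
    have h1 : 0 ≤ sg y g i := Real.sqrt_nonneg _
    have h2 : 0 ≤ 16 * τ * EE y (DD i f) + ρ i := by
      have := ha0 i; have := hρ i; positivity
    refine (mul_le_mul (hsf i) (hsg i) h1 h2).trans (le_of_eq (by ring))
  have c3 := Finset.sum_le_sum fun i (_ : i ∈ univ) => c2 i
  simp only [Finset.sum_add_distrib, ← Finset.mul_sum] at c3
  set δ := 5 * Real.exp (-8 * τ ^ 2) with hδ
  have hδ0 : 0 ≤ δ := by positivity
  have d1 : ∑ i, EE y (DD i f) * ρ' i ≤ 1 * 2 * δ :=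
    (Real.sum_mul_le_sqrt_mul_sqrt univ _ _).trans
      (mul_le_mul haf hρb' (Real.sqrt_nonneg _) (by norm_num))
  have d2 : ∑ i, ρ i * EE y (DD i g) ≤ δ * (1 * 2) :=
    (Real.sum_mul_le_sqrt_mul_sqrt univ _ _).trans
      (mul_le_mul hρb hag (Real.sqrt_nonneg _) hδ0)
  have d3 : ∑ i, ρ i * ρ' i ≤ δ * δ :=
    (Real.sum_mul_le_sqrt_mul_sqrt univ _ _).trans
      (mul_le_mul hρb hρb' (Real.sqrt_nonneg _) hδ0)
  have d4 : 64 * τ * δ + δ * δ ≤ 345 * Real.exp (-τ ^ 2) := by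
    set E := Real.exp (-τ ^ 2) with hE
    have hE0 : 0 < E := Real.exp_pos _
    have hE1 : E ≤ 1 := Real.exp_le_one_iff.2 (by nlinarith)
    have h8 : Real.exp (-8 * τ ^ 2) = E ^ 8 := by
      rw [hE, ← Real.exp_nat_mul]; congr 1; push_cast; ring
    have hτE : τ * E ≤ 1 := by
      have h1 := Real.add_one_le_exp (τ ^ 2)
      have h2 : E * Real.exp (τ ^ 2) = 1 := by rw [hE, ← Real.exp_add]; simp
      have h3 : τ ≤ Real.exp (τ ^ 2) := by nlinarith
      calc τ * E ≤ Real.exp (τ ^ 2) * E := by gcongr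
        _ = 1 := by rw [mul_comm]; exact h2
    have p7 : E ^ 7 ≤ E := by
      calc E ^ 7 ≤ E ^ 1 := pow_le_pow_of_le_one hE0.le hE1 (by norm_num)
        _ = E := pow_one E
    have p16 : E ^ 16 ≤ E := by
      calc E ^ 16 ≤ E ^ 1 := pow_le_pow_of_le_one hE0.le hE1 (by norm_num)
        _ = E := pow_one E
    rw [hδ, h8]
    have q : τ * E * E ^ 7 ≤ 1 * E := mul_le_mul hτE p7 (by positivity) (by norm_num)
    have : 64 * τ * (5 * E ^ 8) + 5 * E ^ 8 * (5 * E ^ 8) = 320 * (τ * E * E ^ 7) + 25 * E ^ 16 := by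
      ring
    rw [this]; linarith
  have c4 := Finset.sum_le_sum fun i (_ : i ∈ univ) => c1 i
  rw [Finset.sum_neg_distrib] at c4
  nlinarith

/-- the point `r z` -/
def sc (r : ℝ) (z : Fin n → Bool) : Fin n → ℝ := fun j => r * eps (z j)

lemma eps_sq (b : Bool) : eps b * eps b = 1 := by cases b <;> simp [eps]

lemma abs_eps (b : Bool) : |eps b| = 1 := by cases b <;> simp [eps]

lemma sc_update (r : ℝ) (z : Fin n → Bool) (i : Fin n) (b : Bool) :
    sc r (Function.update z i b) = Function.update (sc r z) i (r * eps b) := by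
  funext j
  by_cases h : j = i
  · subst h; simp [sc]
  · simp [sc, Function.update_of_ne h]

lemma EE_update_DD (i : Fin n) (y : Fin n → ℝ) (f : (Fin n → Bool) → ℝ) (a : ℝ) :
    EE (Function.update y i a) (DD i f) = EE y (DD i f) := by
  have := EE_affine i y (DD i f) a (y i)
  rw [DD_DD_self, EE_const, Function.update_eq_self] at this
  linarith

lemma EE_deriv (f : (Fin n → Bool) → ℝ) (z : Fin n → Bool) (r : ℝ) :
    HasDerivAt (fun r => EE (sc r z) f) (∑ i, eps (z i) * EE (sc r z) (DD i f)) r := by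
  have h1 : ∀ x, HasDerivAt (fun r => wt (sc r z) x * f x)
      ((∑ i, wt' i (sc r z) x * (eps (x i) * eps (z i) / 2)) * f x) r := by
    intro x
    refine HasDerivAt.mul_const ?_ _
    have h2 : ∀ j ∈ (univ : Finset (Fin n)),
        HasDerivAt (fun r => (1 + eps (x j) * (r * eps (z j))) / 2)
        (eps (x j) * eps (z j) / 2) r := by
      intro j _
      have h3 := ((((hasDerivAt_id r).mul_const (eps (z j))).const_mul (eps (x j))).const_add
        1).div_const 2
      simpa using h3
    have h4 := HasDerivAt.fun_finsetProd h2
    simpa [wt, wt', sc, smul_eq_mul] using h4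
  have h5 := HasDerivAt.fun_sum (u := univ) fun x _ => h1 x
  refine HasDerivAt.congr_deriv h5 (Eq.symm ?_)
  simp_rw [EE_DD', Finset.mul_sum, Finset.sum_mul]
  rw [Finset.sum_comm]
  refine Finset.sum_congr rfl fun x _ => Finset.sum_congr rfl fun i _ => by ring

lemma ibp_zero (f g : (Fin n → Bool) → ℝ) (r : ℝ) (i : Fin n) :
    EE 0 (fun z => eps (z i) * (EE (sc r z) (DD i f) * EE (sc r z) g))
      = r * EE 0 (fun z => EE (sc r z) (DD i f) * EE (sc r z) (DD i g)) := by
  have h := ibp i (0 : Fin n → ℝ) (by simp) (fun z => EE (sc r z) (DD i f) * EE (sc r z) g)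
  have h2 : ∀ z : Fin n → Bool, xi 0 i z = eps (z i) := fun z => by simp [xi]
  simp only [h2] at h
  rw [h, ← EE_smul]
  congr 1; funext z
  rw [DD, sc_update, sc_update, EE_update_DD, EE_update_DD, ← mul_sub, EE_affine]
  simp [eps]; ring

lemma H_deriv (f g : (Fin n → Bool) → ℝ) (r : ℝ) :
    HasDerivAt (fun r => EE 0 (fun z => EE (sc r z) f * EE (sc r z) g))
      (2 * r * ∑ i, EE 0 (fun z => EE (sc r z) (DD i f) * EE (sc r z) (DD i g))) r := by
  have h1 : ∀ z : Fin n → Bool, HasDerivAt (fun r => wt 0 z * (EE (sc r z) f * EE (sc r z) g))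
      (wt 0 z * ((∑ i, eps (z i) * EE (sc r z) (DD i f)) * EE (sc r z) g
        + EE (sc r z) f * ∑ i, eps (z i) * EE (sc r z) (DD i g))) r := fun z =>
    ((EE_deriv f z r).mul (EE_deriv g z r)).const_mul _
  have h5 := HasDerivAt.fun_sum (u := univ) fun x _ => h1 x
  refine HasDerivAt.congr_deriv h5 (Eq.symm ?_)
  change _ = EE 0 (fun z => (∑ i, eps (z i) * EE (sc r z) (DD i f)) * EE (sc r z) g
        + EE (sc r z) f * ∑ i, eps (z i) * EE (sc r z) (DD i g))
  have e1 : EE 0 (fun z => (∑ i, eps (z i) * EE (sc r z) (DD i f)) * EE (sc r z) g)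
      = r * ∑ i, EE 0 (fun z => EE (sc r z) (DD i f) * EE (sc r z) (DD i g)) := by
    simp_rw [Finset.mul_sum, ← ibp_zero]
    rw [← EE_sum]
    congr 1; funext z
    rw [Finset.sum_mul]
    exact Finset.sum_congr rfl fun i _ => by ring
  have e2 : EE 0 (fun z => EE (sc r z) f * ∑ i, eps (z i) * EE (sc r z) (DD i g))
      = r * ∑ i, EE 0 (fun z => EE (sc r z) (DD i f) * EE (sc r z) (DD i g)) := by
    simp_rw [mul_comm (EE _ (DD _ f)) (EE _ (DD _ g)), Finset.mul_sum, ← ibp_zero]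
    rw [← EE_sum]
    congr 1; funext z
    exact Finset.sum_congr rfl fun i _ => by ring
  rw [EE_add, e1, e2]; ring

lemma EE_dirac (f : (Fin n → Bool) → ℝ) (z : Fin n → Bool) : EE (sc 1 z) f = f z := by
  unfold EE
  rw [Finset.sum_eq_single z]
  · have : wt (sc 1 z) z = 1 := by
      unfold wt sc
      refine Finset.prod_eq_one fun j _ => ?_
      rw [one_mul, eps_sq]; norm_num
    rw [this, one_mul]
  · intro x _ hx
    obtain ⟨j, hj⟩ := Function.ne_iff.1 hx
    have : wt (sc 1 z) x = 0 := by
      unfold wt sc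
      refine Finset.prod_eq_zero (mem_univ j) ?_
      revert hj
      cases x j <;> cases z j <;> simp [eps]
    rw [this, zero_mul]
  · simp

lemma sc_zero (z : Fin n → Bool) : sc 0 z = 0 := by funext j; simp [sc]

/-- analytic main statement -/
lemma main_analytic (f g : (Fin n → Bool) → ℝ)
    (hf : ∀ x, |f x| ≤ 1) (hmf : ∀ i x, 0 ≤ DD i f x)
    (hg : ∀ x, |g x| ≤ 1) (hmg : ∀ i x, 0 ≤ DD i g x) (S : ℝ) (hS0 : 0 < S) (hS1 : S ≤ 1)
    (hS : ∑ i, EE 0 (DD i f) * EE 0 (DD i g) = S / 4) :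
    1 / 32768 * (S / Real.log (Real.exp 1 / S)) ≤
      EE 0 (fun x => f x * g x) - EE 0 f * EE 0 g := by
  set ℓ := Real.log (Real.exp 1 / S) with hℓ
  have hℓ' : ℓ = 1 - Real.log S := by
    rw [hℓ, Real.log_div (Real.exp_pos 1).ne' hS0.ne', Real.log_exp]
  have hℓ1 : 1 ≤ ℓ := by rw [hℓ']; linarith [Real.log_nonpos hS0.le hS1]
  set τ := √ℓ with hτd
  have hτ2 : τ ^ 2 = ℓ := Real.sq_sqrt (by linarith)
  have hτ : 1 ≤ τ := Real.one_le_sqrt.2 hℓ1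
  have hE : Real.exp (-τ ^ 2) ≤ S / 2 := by
    rw [hτ2, hℓ', neg_sub, Real.exp_sub, Real.exp_log hS0]
    have : (2 : ℝ) ≤ Real.exp 1 := by linarith [Real.add_one_le_exp (1 : ℝ)]
    gcongr
  set H : ℝ → ℝ := fun r => EE 0 (fun z => EE (sc r z) f * EE (sc r z) g) with hH
  set Φ : ℝ → ℝ := fun r => ∑ i, EE 0 (fun z => EE (sc r z) (DD i f) * EE (sc r z) (DD i g))
    with hΦ
  set Ψ : ℝ → ℝ := fun r => ∑ i, ∑ j,
    EE 0 (fun z => EE (sc r z) (DD j (DD i f)) * EE (sc r z) (DD j (DD i g))) with hΨ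
  have dH : ∀ r, HasDerivAt H (2 * r * Φ r) r := fun r => H_deriv f g r
  have dΦ : ∀ r, HasDerivAt Φ (2 * r * Ψ r) r := by
    intro r
    have := HasDerivAt.fun_sum (u := univ) fun i _ => H_deriv (DD i f) (DD i g) r
    rw [← Finset.mul_sum] at this
    exact this
  have h01 : ∀ i : Fin n, |(0 : Fin n → ℝ) i| ≤ 1 := by simp
  have hsc : ∀ r, 0 ≤ r → ∀ (z : Fin n → Bool) i, |sc r z i| = r := by
    intro r hr z i
    rw [sc, abs_mul, abs_eps, mul_one, abs_of_nonneg hr]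
  have hΦ0 : ∀ r, 0 ≤ r → r ≤ 1 → 0 ≤ Φ r := by
    intro r hr hr1
    refine Finset.sum_nonneg fun i _ => EE_nonneg 0 h01 fun z => ?_
    have hh : ∀ i, |sc r z i| ≤ 1 := fun i => by rw [hsc r hr]; exact hr1
    exact mul_nonneg (EE_nonneg _ hh (hmf i)) (EE_nonneg _ hh (hmg i))
  set A := 256 * ℓ with hA
  set B := 345 * (S / 2) with hB
  have hA0 : 0 < A := by positivity
  have hΨb : ∀ r, 0 ≤ r → r ≤ 1 / 2 → - (A * Φ r + B) ≤ Ψ r := by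
    intro r hr hr1
    have e1 : Ψ r = EE 0 (fun z => ∑ i, ∑ j,
        EE (sc r z) (DD j (DD i f)) * EE (sc r z) (DD j (DD i g))) := by
      rw [EE_sum]
      exact Finset.sum_congr rfl fun i _ => by rw [EE_sum]
    have e2 : - (A * Φ r + B) = EE 0 (fun z => (-A) *
        (∑ i, EE (sc r z) (DD i f) * EE (sc r z) (DD i g)) + (-B)) := by
      rw [EE_add, EE_smul, EE_const, EE_sum]; ring
    rw [e1, e2]
    refine EE_mono 0 h01 fun z => ?_
    have := level_two (sc r z) (fun i => by rw [hsc r hr]; exact hr1) f g hf hmf hg hmg τ hτ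
    rw [hτ2] at this
    rw [hτ2] at hE
    refine le_trans ?_ this
    rw [hA, hB]
    linarith
  have hmono : MonotoneOn (fun r => (Φ r + B / A) * Real.exp (A * r ^ 2)) (Set.Icc 0 (1 / 2)) := by
    have hd : ∀ r, HasDerivAt (fun r => (Φ r + B / A) * Real.exp (A * r ^ 2))
        ((2 * r * Ψ r) * Real.exp (A * r ^ 2)
          + (Φ r + B / A) * (Real.exp (A * r ^ 2) * (A * (2 * r)))) r := by
      intro r
      have h1 : HasDerivAt (fun r : ℝ => A * r ^ 2) (A * (2 * r)) r := by
        simpa using (hasDerivAt_pow 2 r).const_mul A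
      exact ((dΦ r).add_const _).mul h1.exp
    refine monotoneOn_of_deriv_nonneg (convex_Icc _ _)
      (fun r _ => (hd r).continuousAt.continuousWithinAt)
      (fun r _ => (hd r).differentiableAt.differentiableWithinAt) fun r hr => ?_
    rw [interior_Icc] at hr
    rw [(hd r).deriv]
    have h1 := hΨb r hr.1.le hr.2.le
    have h2 : (2 * r * Ψ r) * Real.exp (A * r ^ 2)
          + (Φ r + B / A) * (Real.exp (A * r ^ 2) * (A * (2 * r)))
        = Real.exp (A * r ^ 2) * (2 * r) * (Ψ r + (A * Φ r + B)) := by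
      field_simp
    rw [h2]
    have := hr.1
    refine mul_nonneg (by positivity) (by linarith)
  have hΦz : Φ 0 = S / 4 := by
    rw [← hS]
    refine Finset.sum_congr rfl fun i _ => ?_
    simp only [sc_zero]
    rw [EE_const]
  set r0 := √(1 / (4096 * ℓ)) with hr0
  have hr02 : r0 ^ 2 = 1 / (4096 * ℓ) := Real.sq_sqrt (by positivity)
  have hr0n : 0 ≤ r0 := Real.sqrt_nonneg _
  have hr0q : r0 ^ 2 ≤ 1 / 4096 := by
    rw [hr02]
    apply one_div_le_one_div_of_le <;> linarith
  have hr0h : r0 ≤ 1 / 2 := by nlinarith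
  have hΦlow : ∀ r, 0 ≤ r → r ≤ r0 → S / 8 ≤ Φ r := by
    intro r hr hrr
    have h1 := hmono (Set.left_mem_Icc.2 (by norm_num)) ⟨hr, hrr.trans hr0h⟩ hr
    simp only [hΦz] at h1
    have h1 : S / 4 + B / A ≤ (Φ r + B / A) * Real.exp (A * r ^ 2) := by simpa using h1
    have hr2 : r ^ 2 ≤ r0 ^ 2 := by gcongr
    have h2 := Real.add_one_le_exp (-(A * r ^ 2))
    have h3 : Real.exp (-(A * r ^ 2)) * Real.exp (A * r ^ 2) = 1 := by
      rw [← Real.exp_add]; simp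
    have h4 : (S / 4 + B / A) * Real.exp (-(A * r ^ 2)) ≤ Φ r + B / A := by
      have := mul_le_mul_of_nonneg_right h1 (Real.exp_pos (-(A * r ^ 2))).le
      calc _ ≤ _ := this
        _ = (Φ r + B / A) * (Real.exp (-(A * r ^ 2)) * Real.exp (A * r ^ 2)) := by ring
        _ = _ := by rw [h3, mul_one]
    have hBA : 0 ≤ B / A := by positivity
    have h5 : (S / 4 + B / A) * (-(A * r ^ 2) + 1) ≤ Φ r + B / A :=
      (mul_le_mul_of_nonneg_left h2 (by positivity)).trans h4
    have h6 : (S / 4 + B / A) * (-(A * r ^ 2) + 1)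
        = S / 4 + B / A - S / 4 * (A * r ^ 2) - B * r ^ 2 := by field_simp; ring
    rw [h6] at h5
    have h7 : A * r ^ 2 ≤ 1 / 16 := by
      calc A * r ^ 2 ≤ A * r0 ^ 2 := by gcongr
        _ = 1 / 16 := by rw [hr02, hA]; field_simp; norm_num
    have h8 : B * r ^ 2 ≤ B * (1 / 4096) := by
      have : 0 ≤ B := by positivity
      gcongr; linarith
    have h9 : S / 4 * (A * r ^ 2) ≤ S / 4 * (1 / 16) := by gcongr
    rw [hB] at h8 h5
    linarith
  have hmH : MonotoneOn H (Set.Icc 0 1) := by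
    refine monotoneOn_of_deriv_nonneg (convex_Icc _ _)
      (fun r _ => (dH r).continuousAt.continuousWithinAt)
      (fun r _ => (dH r).differentiableAt.differentiableWithinAt) fun r hr => ?_
    rw [interior_Icc] at hr
    rw [(dH r).deriv]
    have h1 := hΦ0 r hr.1.le hr.2.le
    have := hr.1
    positivity
  have hmH2 : MonotoneOn (fun r => H r - S / 8 * r ^ 2) (Set.Icc 0 r0) := by
    have hd : ∀ r, HasDerivAt (fun r => H r - S / 8 * r ^ 2) (2 * r * Φ r - S / 8 * (2 * r)) r := by
      intro r
      have h1 : HasDerivAt (fun r : ℝ => S / 8 * r ^ 2) (S / 8 * (2 * r)) r := by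
        simpa using (hasDerivAt_pow 2 r).const_mul (S / 8)
      exact (dH r).sub h1
    refine monotoneOn_of_deriv_nonneg (convex_Icc _ _)
      (fun r _ => (hd r).continuousAt.continuousWithinAt)
      (fun r _ => (hd r).differentiableAt.differentiableWithinAt) fun r hr => ?_
    rw [interior_Icc] at hr
    rw [(hd r).deriv]
    have h1 := hΦlow r hr.1.le hr.2.le
    have := hr.1
    nlinarith
  have k1 := hmH2 (Set.left_mem_Icc.2 hr0n) (Set.right_mem_Icc.2 hr0n) hr0n
  have k2 := hmH (⟨hr0n, by linarith⟩ : r0 ∈ Set.Icc (0 : ℝ) 1) (Set.right_mem_Icc.2 zero_le_one)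
    (by linarith : r0 ≤ 1)
  have k3 : H 1 = EE 0 (fun x => f x * g x) := by
    simp only [hH, EE_dirac]
  have k4 : H 0 = EE 0 f * EE 0 g := by
    simp only [hH, sc_zero]
    rw [EE_const]
  have k5 : S / 8 * r0 ^ 2 = 1 / 32768 * (S / ℓ) := by
    rw [hr02]; field_simp; norm_num
  rw [← k3, ← k4, ← k5]
  simp only at k1
  nlinarith

lemma cov_nonneg (f g : (Fin n → Bool) → ℝ)
    (hmf : ∀ i x, 0 ≤ DD i f x) (hmg : ∀ i x, 0 ≤ DD i g x) :
    0 ≤ EE 0 (fun x => f x * g x) - EE 0 f * EE 0 g := by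
  have h01 : ∀ i : Fin n, |(0 : Fin n → ℝ) i| ≤ 1 := by simp
  have hmH : MonotoneOn (fun r => EE 0 (fun z => EE (sc r z) f * EE (sc r z) g))
      (Set.Icc 0 1) := by
    refine monotoneOn_of_deriv_nonneg (convex_Icc _ _)
      (fun r _ => (H_deriv f g r).continuousAt.continuousWithinAt)
      (fun r _ => (H_deriv f g r).differentiableAt.differentiableWithinAt) fun r hr => ?_
    rw [interior_Icc] at hr
    rw [(H_deriv f g r).deriv]
    refine mul_nonneg (by linarith [hr.1]) ?_
    refine Finset.sum_nonneg fun i _ => EE_nonneg 0 h01 fun z => ?_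
    have hh : ∀ i, |sc r z i| ≤ 1 := fun i => by
      rw [sc, abs_mul, abs_eps, mul_one, abs_of_nonneg hr.1.le]; exact hr.2.le
    exact mul_nonneg (EE_nonneg _ hh (hmf i)) (EE_nonneg _ hh (hmg i))
  have k := hmH (Set.left_mem_Icc.2 zero_le_one) (Set.right_mem_Icc.2 zero_le_one) zero_le_one
  simp only [EE_dirac, sc_zero] at k
  rw [EE_const] at k
  linarith

lemma DD_nonneg {f : (Fin n → Bool) → ℝ} (hf : Monotone f) (i : Fin n) (x : Fin n → Bool) :
    0 ≤ DD i f x := by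
  have : f (Function.update x i false) ≤ f (Function.update x i true) := by
    apply hf
    exact update_le_update_iff.2 ⟨Bool.false_le _, fun _ _ => le_rfl⟩
  unfold DD; linarith

lemma cubeExp_eq (f : (Fin n → Bool) → ℝ) : cubeExp f = EE 0 f := by
  unfold cubeExp EE wt
  rw [Finset.sum_div]
  refine Finset.sum_congr rfl fun x _ => ?_
  simp
  ring

lemma cubeInfluence_eq {f : (Fin n → Bool) → ℝ} (hf : Monotone f) (i : Fin n) :
    cubeInfluence f i = 2 * EE 0 (DD i f) := by
  unfold cubeInfluence
  rw [cubeExp_eq, ← EE_smul]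
  congr 1; funext x
  have h := DD_nonneg hf i x
  have h2 : |2 * DD i f x| = 2 * DD i f x := abs_of_nonneg (by linarith)
  rw [← h2]
  have h3 : 2 * DD i f x = f (Function.update x i true) - f (Function.update x i false) := by
    unfold DD; ring
  rw [h3]
  cases hx : x i
  · have : Function.update x i false = x := by rw [← hx]; simp
    rw [this, abs_sub_comm]; simp
  · have : Function.update x i true = x := by rw [← hx]; simp
    rw [this]; simp

lemma a_half (f : (Fin n → Bool) → ℝ) (hf : ∀ x, f x ∈ Set.Icc (0 : ℝ) 1) :
    √(∑ i, EE 0 (DD i f) ^ 2) ≤ 1 / 2 := by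
  have h := a_bd (0 : Fin n → ℝ) (by simp) (fun x => f x - 1 / 2) (1 / 2) 1 (by norm_num)
    (by norm_num) (fun x => by
      obtain ⟨l, u⟩ := hf x
      rw [abs_le]; constructor <;> linarith) (by simp)
  have h2 : ∀ i, DD i (fun x => f x - 1 / 2) = DD i f := by
    intro i; funext x; simp [DD]
  simpa only [h2, mul_one] using h

end

end Tal

/-- **Theorem (functional Talagrand correlation inequality on the discrete cube).**
There is a universal constant `c > 0` such that for any `n ≥ 1` and any pair of increasing
functions `f, g : {−1,1}ⁿ → [0,1]` (where `false` plays the role of `−1 < 1 = true`),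
`E_ν[fg] − E_ν[f]·E_ν[g] ≥ c·φ(∑ i, I_i(f)·I_i(g))` with `φ(x) = x / log(e/x)`. -/
theorem discrete_talagrand_functional :
    ∃ c : ℝ, 0 < c ∧
      ∀ (n : ℕ), 1 ≤ n → ∀ (f g : (Fin n → Bool) → ℝ),
        Monotone f → Monotone g →
        (∀ x, f x ∈ Set.Icc (0 : ℝ) 1) → (∀ x, g x ∈ Set.Icc (0 : ℝ) 1) →
        cubeExp (fun x => f x * g x) - cubeExp f * cubeExp g ≥
          c * ((∑ i, cubeInfluence f i * cubeInfluence g i) /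
            Real.log (Real.exp 1 / ∑ i, cubeInfluence f i * cubeInfluence g i)) := by
  refine ⟨1 / 32768, by norm_num, ?_⟩
  intro n _ f g hf hg hf1 hg1
  have hmf := fun i x => Tal.DD_nonneg hf i x
  have hmg := fun i x => Tal.DD_nonneg hg i x
  have h01 : ∀ i : Fin n, |(0 : Fin n → ℝ) i| ≤ 1 := by simp
  have habs : ∀ u : ℝ, u ∈ Set.Icc (0 : ℝ) 1 → |u| ≤ 1 := fun u hu => by
    rw [abs_of_nonneg hu.1]; exact hu.2
  simp only [Tal.cubeExp_eq, Tal.cubeInfluence_eq hf, Tal.cubeInfluence_eq hg]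
  set S := ∑ i, 2 * Tal.EE 0 (Tal.DD i f) * (2 * Tal.EE 0 (Tal.DD i g)) with hSd
  have hS4 : ∑ i, Tal.EE 0 (Tal.DD i f) * Tal.EE 0 (Tal.DD i g) = S / 4 := by
    rw [hSd, Finset.sum_div]
    exact Finset.sum_congr rfl fun i _ => by ring
  have hS0 : 0 ≤ S := Finset.sum_nonneg fun i _ => by
    have h1 := Tal.EE_nonneg 0 h01 (hmf i)
    have h2 := Tal.EE_nonneg 0 h01 (hmg i)
    positivity
  have hS1 : S ≤ 1 := by
    have h := Real.sum_mul_le_sqrt_mul_sqrt Finset.univ (fun i => Tal.EE 0 (Tal.DD i f))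
      (fun i => Tal.EE 0 (Tal.DD i g))
    have h2 := mul_le_mul (Tal.a_half f hf1) (Tal.a_half g hg1) (Real.sqrt_nonneg _)
      (by norm_num)
    rw [hS4] at h
    linarith
  rcases hS0.eq_or_lt with h | h
  · rw [← h]
    simp only [zero_div, mul_zero]
    -- covariance is nonnegative
    exact Tal.cov_nonneg f g hmf hmg
  · exact Tal.main_analytic f g (fun x => habs _ (hf1 x)) hmf (fun x => habs _ (hg1 x)) hmg S h hS1
      hS4
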